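/- arXiv:1210.6543 — 3 statements merged into one kernel-verified Lean document; each statement's English description precedes it below -/
import Mathlib

section
/- Let E/ℚ be an elliptic curve given by a Weierstrass equation with integer coefficients, and assume Conjecture 1.1 holds for E. Then for all ε > 0 there exists a constant c'_ε such that log v_Q ≤ ε·log rad(d_Q) + c'_ε for all Q ∈ E(ℚ)\{O}, where v_Q is the powerful part of d_Q. -/
open WeierstrassCurve

/-- The radical of a positive integer: product of its distinct prime factors. -/
def rad (n : ℕ) : ℕ := ∏ p ∈ n.primeFactors, p

/-- The squarefree part: the product of the primes dividing `n` exactly once. -/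
def sqfreePart (n : ℕ) : ℕ :=
  ∏ p ∈ n.primeFactors.filter fun p => n.factorization p = 1, p

/-- The powerful part: the product of `p ^ v_p(n)` over the primes `p` with `v_p(n) ≥ 2`. -/
def powerfulPart (n : ℕ) : ℕ :=
  ∏ p ∈ n.primeFactors.filter fun p => 2 ≤ n.factorization p, p ^ n.factorization p

/-- `(x, y) = (a/d², b/d³)` with `d ≥ 1` and `gcd(d, ab) = 1`; for an affine point of an
elliptic curve over `ℚ` given by an integral Weierstrass equation, such `a`, `b`, `d` exist
and are unique, namely `a = a_P`, `b = b_P`, `d = d_P`. -/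
def IsDecomp (x y : ℚ) (a b d : ℤ) : Prop :=
  1 ≤ d ∧ Int.gcd d (a * b) = 1 ∧ x = (a : ℚ) / (d : ℚ) ^ 2 ∧ y = (b : ℚ) / (d : ℚ) ^ 3

/-- The base change to `ℚ` of an integral Weierstrass equation, in affine coordinates. -/
def EQ (W : WeierstrassCurve ℤ) : WeierstrassCurve.Affine ℚ :=
  (W.map (Int.castRingHom ℚ)).toAffine

/-- Conjecture 1.1: for all `ε > 0` there is a constant `c_ε` with
`max ((1/2)·log |a_P|, log d_P) ≤ (1 + ε)·log rad d_P + c_ε` for all `P ∈ E(ℚ) \ {O}`. -/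
def Conj11 (W : WeierstrassCurve ℤ) : Prop :=
  ∀ ε : ℝ, 0 < ε → ∃ c : ℝ, ∀ x y : ℚ, (EQ W).Nonsingular x y →
    ∀ a b d : ℤ, IsDecomp x y a b d →
      max (1 / 2 * Real.log |(a : ℝ)|) (Real.log (d : ℝ)) ≤
        (1 + ε) * Real.log (rad d.toNat : ℝ) + c

theorem powerfulPart_mul_rad_sq_le {n : ℕ} (hn : n ≠ 0) :
    powerfulPart n * rad n ^ 2 ≤ n ^ 2 := by
  have hprod : ∏ p ∈ n.primeFactors, p ^ n.factorization p = n :=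
    Nat.prod_factorization_pow_eq_self hn
  calc powerfulPart n * rad n ^ 2
      = ∏ p ∈ n.primeFactors,
          (if 2 ≤ n.factorization p then p ^ n.factorization p else 1) * p ^ 2 := by
        rw [powerfulPart, rad, Finset.prod_filter, Finset.prod_mul_distrib, Finset.prod_pow]
    _ ≤ ∏ p ∈ n.primeFactors, (p ^ n.factorization p) ^ 2 := by
        refine Finset.prod_le_prod' fun p hp => ?_
        have hp0 : 0 < p := Nat.pos_of_mem_primeFactors hp
        have hk : 1 ≤ n.factorization p :=
          (Nat.prime_of_mem_primeFactors hp).factorization_pos_of_dvd hn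
            (Nat.dvd_of_mem_primeFactors hp)
        rw [← pow_mul]
        split_ifs with h
        · rw [← pow_add]
          exact Nat.pow_le_pow_right hp0 (by omega)
        · rw [one_mul]
          exact Nat.pow_le_pow_right hp0 (by omega)
    _ = n ^ 2 := by rw [Finset.prod_pow, hprod]

theorem rad_pos (n : ℕ) : 0 < rad n :=
  Finset.prod_pos fun _ hp => Nat.pos_of_mem_primeFactors hp

theorem powerfulPart_pos (n : ℕ) : 0 < powerfulPart n :=
  Finset.prod_pos fun _ hp =>
    pow_pos (Nat.pos_of_mem_primeFactors (Finset.mem_filter.mp hp).1) _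

theorem log_powerfulPart_le {n : ℕ} (hn : n ≠ 0) :
    Real.log (powerfulPart n) ≤ 2 * (Real.log n - Real.log (rad n)) := by
  have hv : (0 : ℝ) < powerfulPart n := mod_cast powerfulPart_pos n
  have hr : (0 : ℝ) < rad n := mod_cast rad_pos n
  have h : (powerfulPart n : ℝ) * (rad n : ℝ) ^ 2 ≤ (n : ℝ) ^ 2 :=
    mod_cast powerfulPart_mul_rad_sq_le hn
  have hlog := Real.log_le_log (by positivity) h
  rw [Real.log_mul hv.ne' (by positivity), Real.log_pow, Real.log_pow] at hlog
  push_cast at hlog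
  linarith

/-- assuming Conjecture 1.1, for all `ε > 0` there is a constant `c'_ε` such that
`log v_Q ≤ ε·log rad d_Q + c'_ε` for all `Q ∈ E(ℚ) \ {O}`, where `v_Q` is the powerful part
of `d_Q`. -/
theorem stmt6 (W : WeierstrassCurve ℤ) (hΔ : W.Δ ≠ 0) (hconj : Conj11 W) :
    ∀ ε : ℝ, 0 < ε → ∃ c : ℝ, ∀ x y : ℚ, (EQ W).Nonsingular x y →
      ∀ a b d : ℤ, IsDecomp x y a b d →
        Real.log (powerfulPart d.toNat : ℝ) ≤ ε * Real.log (rad d.toNat : ℝ) + c := by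
  intro ε hε
  obtain ⟨c, hc⟩ := hconj (ε / 2) (by positivity)
  refine ⟨2 * c, fun x y hxy a b d hd => ?_⟩
  have hlog := (le_max_right _ _).trans (hc x y hxy a b d hd)
  have hd1 := hd.1
  have hcast : ((d.toNat : ℕ) : ℝ) = (d : ℝ) := mod_cast Int.toNat_of_nonneg (by omega)
  have hv := log_powerfulPart_le (n := d.toNat) (by omega)
  rw [hcast] at hv
  linarith
end

section
/- Let E/ℚ be an elliptic curve given by a Weierstrass equation with integer coefficients, and assume Conjecture 1.1 holds for E. Then for all ε > 0 there exists a constant c such that log(v_Q / rad(v_Q)) ≤ ε·log rad(d_Q) + c for all Q ∈ E(ℚ)\{O}, where v_Q is the powerful part of d_Q. -/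
open WeierstrassCurve

theorem primeFactors_powerfulPart (n : ℕ) :
    (powerfulPart n).primeFactors = n.primeFactors.filter fun p => 2 ≤ n.factorization p := by
  have hne : powerfulPart n ≠ 0 := Finset.prod_ne_zero_iff.2 fun p hp =>
    pow_ne_zero _ (Nat.prime_of_mem_primeFactors (Finset.mem_filter.1 hp).1).ne_zero
  ext q
  rw [Nat.mem_primeFactors]
  constructor
  · rintro ⟨hq, hdvd, -⟩
    obtain ⟨p, hp, hqp⟩ := (hq.prime.dvd_finsetProd_iff _).1 hdvd
    have hpp := Nat.prime_of_mem_primeFactors (Finset.mem_filter.1 hp).1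
    rwa [(Nat.prime_dvd_prime_iff_eq hq hpp).1 (hq.dvd_of_dvd_pow hqp)]
  · intro hq
    have hq' := Finset.mem_filter.1 hq
    exact ⟨Nat.prime_of_mem_primeFactors hq'.1,
      (dvd_pow_self q (by omega)).trans
        (Finset.dvd_prod_of_mem (fun p => p ^ n.factorization p) hq), hne⟩

/-- `n / rad n = v / rad v`, where `v` is the powerful part of `n`. -/
theorem powerfulPart_mul_rad {n : ℕ} (hn : n ≠ 0) :
    powerfulPart n * rad n = n * rad (powerfulPart n) := by
  have hrad : rad (powerfulPart n) =
      ∏ p ∈ n.primeFactors.filter fun p => 2 ≤ n.factorization p, p := by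
    rw [rad, primeFactors_powerfulPart]
  have hsimple : ∏ p ∈ n.primeFactors.filter (fun p => ¬ 2 ≤ n.factorization p),
      p ^ n.factorization p =
        ∏ p ∈ n.primeFactors.filter (fun p => ¬ 2 ≤ n.factorization p), p := by
    refine Finset.prod_congr rfl fun p hp => ?_
    obtain ⟨hp, h2⟩ := Finset.mem_filter.1 hp
    have hpos := (Nat.prime_of_mem_primeFactors hp).factorization_pos_of_dvd hn
      (Nat.dvd_of_mem_primeFactors hp)
    rw [show n.factorization p = 1 by omega, pow_one]
  have hfact : ∏ p ∈ n.primeFactors, p ^ n.factorization p = n :=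
    Nat.prod_factorization_pow_eq_self hn
  rw [← Finset.prod_filter_mul_prod_filter_not _ (fun p => 2 ≤ n.factorization p),
    hsimple] at hfact
  have hsplit := Finset.prod_filter_mul_prod_filter_not n.primeFactors
    (fun p => 2 ≤ n.factorization p) (fun p => p)
  rw [← hrad] at hsplit
  calc powerfulPart n * rad n
      = powerfulPart n * (∏ p ∈ n.primeFactors.filter (fun p => ¬ 2 ≤ n.factorization p), p) *
          rad (powerfulPart n) := by
        rw [rad, ← hsplit]
        ring
    _ = n * rad (powerfulPart n) := congrArg (· * rad (powerfulPart n)) hfact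

/-- assuming Conjecture 1.1, for all `ε > 0` there is a constant `c` such that
`log (v_Q / rad v_Q) ≤ ε·log rad d_Q + c` for all `Q ∈ E(ℚ) \ {O}`, where `v_Q` is the
powerful part of `d_Q`. -/
theorem stmt7 (W : WeierstrassCurve ℤ) (hΔ : W.Δ ≠ 0) (hconj : Conj11 W) :
    ∀ ε : ℝ, 0 < ε → ∃ c : ℝ, ∀ x y : ℚ, (EQ W).Nonsingular x y →
      ∀ a b d : ℤ, IsDecomp x y a b d →
        Real.log ((powerfulPart d.toNat : ℝ) / (rad (powerfulPart d.toNat) : ℝ)) ≤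
          ε * Real.log (rad d.toNat : ℝ) + c := by
  intro ε hε
  obtain ⟨c, hc⟩ := hconj ε hε
  refine ⟨c, fun x y hxy a b d hd => ?_⟩
  have hbound := (le_max_right _ _).trans (hc x y hxy a b d hd)
  have hd0 : 0 < d.toNat := by have := hd.1; omega
  have hcast : (d : ℝ) = (d.toNat : ℝ) := by
    exact_mod_cast (Int.toNat_of_nonneg (by have := hd.1; omega)).symm
  have hrad : (0 : ℝ) < rad d.toNat := by exact_mod_cast rad_pos _
  have hradv : (0 : ℝ) < rad (powerfulPart d.toNat) := by exact_mod_cast rad_pos _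
  have hdpos : (0 : ℝ) < d.toNat := by exact_mod_cast hd0
  have hquot : (powerfulPart d.toNat : ℝ) / (rad (powerfulPart d.toNat) : ℝ) =
      (d.toNat : ℝ) / (rad d.toNat : ℝ) := by
    rw [div_eq_div_iff hradv.ne' hrad.ne']
    exact_mod_cast powerfulPart_mul_rad hd0.ne'
  rw [hquot, Real.log_div hdpos.ne' hrad.ne']
  rw [hcast] at hbound
  linarith
end

section
/- Let E/ℚ be an elliptic curve given by a Weierstrass equation with integer coefficients, and assume Conjecture 1.1 holds for E. Then for every bound B ≥ 1 there exists a constant C (depending on E and B) such that every point P ∈ E(ℚ)\{O} whose squarefree part d'_P satisfies d'_P ≤ B also satisfies d_P ≤ C. -/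
open WeierstrassCurve

theorem rad_sq_le_mul_sqfreePart {n : ℕ} (hn : n ≠ 0) : rad n ^ 2 ≤ n * sqfreePart n := by
  have hfac : ∏ p ∈ n.primeFactors, p ^ n.factorization p = n :=
    Nat.prod_factorization_pow_eq_self hn
  suffices h : rad n ^ 2 ≤ (∏ p ∈ n.primeFactors, p ^ n.factorization p) * sqfreePart n by
    rwa [hfac] at h
  rw [rad, sqfreePart, Finset.prod_filter, ← Finset.prod_pow, ← Finset.prod_mul_distrib]
  refine Finset.prod_le_prod' fun p hp => ?_
  have hprime := Nat.prime_of_mem_primeFactors hp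
  have hv : 1 ≤ n.factorization p :=
    hprime.factorization_pos_of_dvd hn (Nat.dvd_of_mem_primeFactors hp)
  split_ifs with h
  · rw [h, pow_one, sq]
  · rw [mul_one]
    exact Nat.pow_le_pow_right hprime.pos (by omega)

/-- assuming Conjecture 1.1, for every bound `B ≥ 1` there is a constant `C`
such that every `P ∈ E(ℚ) \ {O}` with squarefree part `d'_P ≤ B` satisfies `d_P ≤ C`. -/
theorem stmt8 (W : WeierstrassCurve ℤ) (hΔ : W.Δ ≠ 0) (hconj : Conj11 W)
    (B : ℕ) (hB : 1 ≤ B) :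
    ∃ C : ℝ, ∀ x y : ℚ, (EQ W).Nonsingular x y →
      ∀ a b d : ℤ, IsDecomp x y a b d → sqfreePart d.toNat ≤ B → (d : ℝ) ≤ C := by
  obtain ⟨c, hc⟩ := hconj (1 / 2) (by norm_num)
  refine ⟨Real.exp (3 * Real.log B + 4 * c), fun x y hxy a b d hd hsq => ?_⟩
  have hlog := (le_max_right _ _).trans (hc x y hxy a b d hd)
  have hd1 : 1 ≤ d := hd.1
  lift d to ℕ using by omega
  rw [Int.toNat_natCast] at hsq hlog
  rw [Int.cast_natCast] at hlog ⊢
  have hd0 : d ≠ 0 := by omega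
  have hdpos : (0 : ℝ) < d := by exact_mod_cast Nat.pos_of_ne_zero hd0
  have hBpos : (0 : ℝ) < B := by exact_mod_cast hB
  have hradpos : (0 : ℝ) < rad d := by exact_mod_cast rad_pos d
  have hrad : (rad d : ℝ) ^ 2 ≤ d * B := by
    exact_mod_cast (rad_sq_le_mul_sqfreePart hd0).trans (Nat.mul_le_mul_left d hsq)
  have hlograd := Real.log_le_log (pow_pos hradpos 2) hrad
  rw [Real.log_pow, Real.log_mul hdpos.ne' hBpos.ne'] at hlograd
  push_cast at hlograd
  rw [← Real.log_le_iff_le_exp hdpos]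
  linarith
end
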